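/- arXiv:1612.08347 — 6 statements merged into one kernel-verified Lean document; each statement's English description precedes it below -/
import Mathlib

section
/- For every triangle-free simple graph G, elb(G) ≤ cc(L(G)); that is, the minimum size of an elbow cover of G is at most the minimum number of chordal graphs whose union is the line graph of G. -/
open SimpleGraph

/-- A graph is chordal if it has no induced cycle of length more than three. -/
def IsChordal {V : Type*} (G : SimpleGraph V) : Prop :=
  ∀ n : ℕ, 3 < n → IsEmpty (cycleGraph n ↪g G)

/-- A graph is an interval graph if it is the intersection graph of a family of
closed real intervals. -/
def IsIntervalGraph {V : Type*} (G : SimpleGraph V) : Prop :=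
  ∃ a b : V → ℝ, (∀ v, a v ≤ b v) ∧
    ∀ u v, G.Adj u v ↔ u ≠ v ∧ (Set.Icc (a u) (b u) ∩ Set.Icc (a v) (b v)).Nonempty

/-- A graph is an equivalence graph if it is a disjoint union of cliques. -/
def IsEquivalenceGraph {V : Type*} (G : SimpleGraph V) : Prop :=
  ∀ u v w, G.Adj u v → G.Adj v w → u ≠ w → G.Adj u w

/-- The minimum number of graphs satisfying `P` whose (edge-)union is `G`. -/
noncomputable def coverNumber {V : Type*} (P : SimpleGraph V → Prop)
    (G : SimpleGraph V) : ℕ :=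
  sInf {k | ∃ f : Fin k → SimpleGraph V, (∀ i, P (f i)) ∧ (⨆ i, f i) = G}

/-- The chordal covering number. -/
noncomputable def chordalCoverNumber {V : Type*} (G : SimpleGraph V) : ℕ :=
  coverNumber IsChordal G

/-- The track number. -/
noncomputable def trackNumber {V : Type*} (G : SimpleGraph V) : ℕ :=
  coverNumber IsIntervalGraph G

/-- The equivalence covering number. -/
noncomputable def eqCoverNumber {V : Type*} (G : SimpleGraph V) : ℕ :=
  coverNumber IsEquivalenceGraph G

/-- An orientation of a simple graph: each edge gets exactly one of its two directions. -/
structure GraphOrientation {V : Type*} (G : SimpleGraph V) where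
  dir : V → V → Prop
  adj_iff : ∀ u v, G.Adj u v ↔ (dir u v ∨ dir v u)
  asymm : ∀ u v, dir u v → ¬ dir v u

/-- Edges `xy` and `xz` form an elbow at `x`: both towards `x` or both away from `x`. -/
def GraphOrientation.IsElbow {V : Type*} {G : SimpleGraph V} (o : GraphOrientation G)
    (x y z : V) : Prop :=
  (o.dir y x ∧ o.dir z x) ∨ (o.dir x y ∧ o.dir x z)

/-- Edges `xy` and `xz` form an in-elbow at `x`: both directed towards `x`. -/
def GraphOrientation.IsInElbow {V : Type*} {G : SimpleGraph V} (o : GraphOrientation G)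
    (x y z : V) : Prop :=
  o.dir y x ∧ o.dir z x

/-- The minimum size of an elbow cover of `G`. -/
noncomputable def elbowCoverNumber {V : Type*} (G : SimpleGraph V) : ℕ :=
  sInf {k | ∃ f : Fin k → GraphOrientation G,
    ∀ x y z, G.Adj x y → G.Adj x z → y ≠ z → ∃ i, (f i).IsElbow x y z}

/-- The minimum size of an in-elbow cover of `G`. -/
noncomputable def inElbowCoverNumber {V : Type*} (G : SimpleGraph V) : ℕ :=
  sInf {k | ∃ f : Fin k → GraphOrientation G,
    ∀ x y z, G.Adj x y → G.Adj x z → y ≠ z → ∃ i, (f i).IsInElbow x y z}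

/-- The graph on the darts of `G` in which two darts are adjacent if their edges are adjacent
in `H` and they share their tail or their head, so that they form an elbow. -/
def elbowDartGraph {V : Type*} {G : SimpleGraph V} (H : SimpleGraph G.edgeSet) :
    SimpleGraph G.Dart where
  Adj d d' := H.Adj ⟨d.edge, d.edge_mem⟩ ⟨d'.edge, d'.edge_mem⟩ ∧ (d.fst = d'.fst ∨ d.snd = d'.snd)
  symm := ⟨fun _ _ h => ⟨h.1.symm, h.2.imp Eq.symm Eq.symm⟩⟩
  loopless := ⟨fun _ h => H.irrefl h.1⟩

lemma cycleGraph_adj_iff_of_lt {n : ℕ} {u v : Fin n} (h : u < v) :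
    (cycleGraph n).Adj u v ↔ v.val = u.val + 1 ∨ (u.val = 0 ∧ v.val + 1 = n) := by
  have hv := v.isLt
  have huv : u.val < v.val := h
  rw [cycleGraph_adj', Fin.val_sub, Fin.val_sub, Nat.mod_eq_of_lt (by omega : n - v.val + u.val < n),
    Nat.mod_eq_sub_mod (by omega : n ≤ n - u.val + v.val), Nat.mod_eq_of_lt (by omega)]
  omega

lemma exists_walk_getVert {V : Type*} {G : SimpleGraph V} {u v : V} (p : G.Walk u v) {i j : ℕ}
    (hij : i ≤ j) (hj : j ≤ p.length) :
    ∃ q : G.Walk (p.getVert i) (p.getVert j), q.length = j - i := by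
  refine ⟨((p.drop i).take (j - i)).copy rfl ?_, ?_⟩
  · rw [Walk.drop_getVert, Nat.add_sub_cancel' hij]
  · rw [Walk.length_copy, Walk.take_length, Walk.drop_length]
    omega

namespace elbowDartGraph

variable {V : Type*} {G : SimpleGraph V} {H : SimpleGraph G.edgeSet}

lemma adj_symm {d d' : G.Dart} (h : (elbowDartGraph H).Adj d d') :
    (elbowDartGraph H).Adj d.symm d'.symm := by
  refine ⟨?_, h.2.symm⟩
  simpa only [Dart.edge_symm] using h.1

lemma not_adj_symm {d d' : G.Dart} (h : (elbowDartGraph H).Adj d d') :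
    ¬ (elbowDartGraph H).Adj d d'.symm := by
  rintro ⟨-, h'⟩
  have h1 := d.fst_ne_snd
  have h2 := d'.fst_ne_snd
  have h3 := h.2
  simp only [Dart.symm_toProd, Prod.fst_swap, Prod.snd_swap] at h'
  grind

lemma adj_or_adj_symm (hH : H ≤ G.lineGraph) {d d' : G.Dart}
    (h : H.Adj ⟨d.edge, d.edge_mem⟩ ⟨d'.edge, d'.edge_mem⟩) :
    (elbowDartGraph H).Adj d d' ∨ (elbowDartGraph H).Adj d d'.symm := by
  obtain ⟨-, v, hv, hv'⟩ := lineGraph_adj_iff_exists.1 (hH h)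
  simp only [Dart.edge, Sym2.mem_iff] at hv hv'
  have h' : H.Adj ⟨d.edge, d.edge_mem⟩ ⟨d'.symm.edge, d'.symm.edge_mem⟩ := by
    simpa only [Dart.edge_symm] using h
  have : (d.fst = d'.fst ∨ d.snd = d'.snd) ∨ (d.fst = d'.snd ∨ d.snd = d'.fst) := by grind
  exact this.imp (⟨h, ·⟩) (⟨h', ·⟩)

lemma not_three_walk (hG : G.CliqueFree 3) {a b c : G.Dart} (hab : (elbowDartGraph H).Adj a b)
    (hbc : (elbowDartGraph H).Adj b c) : ¬ (elbowDartGraph H).Adj c a.symm := by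
  rintro ⟨-, hca⟩
  have key : ∀ x y z, G.Adj x y → G.Adj y z → ¬ G.Adj x z := fun x y z hxy hyz hxz => by
    classical
    exact hG {x, y, z} (is3Clique_triple_iff.2 ⟨hxy, hxz, hyz⟩)
  have h1 := a.adj
  have h2 := b.adj
  have h3 := c.adj
  have h1' := a.adj.symm
  have h2' := b.adj.symm
  have h3' := c.adj.symm
  have h4 := a.fst_ne_snd
  have h5 := b.fst_ne_snd
  have h6 := c.fst_ne_snd
  simp only [Dart.symm_toProd, Prod.fst_swap, Prod.snd_swap] at hca
  rcases hab.2 with e1 | e1 <;> rcases hbc.2 with e2 | e2 <;> rcases hca with e3 | e3 <;> grind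

/-- A shortest walk of the dart graph from a dart to its reverse traces an induced cycle. -/
lemma not_reachable_symm (hG : G.CliqueFree 3) (hH : H ≤ G.lineGraph) (hc : IsChordal H)
    (d : G.Dart) : ¬ (elbowDartGraph H).Reachable d d.symm := by
  classical
  rintro ⟨p₀⟩
  have hex : ∃ n, ∃ (d : G.Dart) (p : (elbowDartGraph H).Walk d d.symm), p.length = n :=
    ⟨_, d, p₀, rfl⟩
  obtain ⟨a, p, hp⟩ := Nat.find_spec hex
  have hmin : ∀ (d : G.Dart) (q : (elbowDartGraph H).Walk d d.symm), p.length ≤ q.length :=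
    fun d q => hp ▸ Nat.find_min' hex ⟨d, q, rfl⟩
  clear hp hex p₀ d
  have h0 : p.getVert 0 = a := p.getVert_zero
  have hn : p.getVert p.length = a.symm := p.getVert_length
  have hstep : ∀ i < p.length, (elbowDartGraph H).Adj (p.getVert i) (p.getVert (i + 1)) :=
    fun i hi => p.adj_getVert_succ hi
  have hA : ∀ i j, i ≤ j → j ≤ p.length → (elbowDartGraph H).Adj (p.getVert i) (p.getVert j) →
      j ≤ i + 1 := by
    intro i j hij hj h
    have := hmin a ((p.take i).append (Walk.cons h (p.drop j)))
    simp only [Walk.length_append, Walk.length_cons, Walk.take_length, Walk.drop_length] at this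
    omega
  have hB : ∀ i j, i ≤ j → j ≤ p.length →
      (elbowDartGraph H).Adj (p.getVert i) (p.getVert j).symm → p.length ≤ j - i + 1 := by
    intro i j hij hj h
    obtain ⟨q, hq⟩ := exists_walk_getVert p hij hj
    have h' := (adj_symm h).symm
    rw [Dart.symm_symm] at h'
    simpa [hq] using hmin _ (q.concat h')
  have hC : ∀ i j, i < j → j ≤ p.length → p.getVert i ≠ p.getVert j := by
    intro i j hij hj h
    have := hmin a ((p.take i).append ((p.drop j).copy h.symm rfl))
    simp only [Walk.length_append, Walk.length_copy, Walk.take_length, Walk.drop_length] at this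
    omega
  have hD : ∀ i j, i ≤ j → j ≤ p.length → p.getVert i = (p.getVert j).symm →
      p.length ≤ j - i := by
    intro i j hij hj h
    obtain ⟨q, hq⟩ := exists_walk_getVert p hij hj
    have h' : p.getVert j = (p.getVert i).symm := by rw [h, Dart.symm_symm]
    simpa [hq] using hmin _ (q.copy rfl h')
  have hlen : 3 < p.length := by
    by_contra! hle
    interval_cases hl : p.length
    · exact a.symm_ne (hn.symm.trans h0)
    · have h := hstep 0 one_pos
      rw [h0, zero_add, hn] at h
      have h' := h.1
      simp only [Dart.edge_symm] at h'
      exact H.irrefl h'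
    · have h := hstep 0 two_pos
      have h' := hstep 1 one_lt_two
      rw [h0] at h
      rw [one_add_one_eq_two, hn] at h'
      exact not_adj_symm h.symm h'
    · have h := hstep 0 (by omega)
      have h' := hstep 1 (by omega)
      have h'' := hstep 2 (by omega)
      rw [h0] at h
      rw [hn] at h''
      exact not_three_walk hG h h' h''
  have hne : ∀ i j, i < j → j < p.length → (p.getVert i).edge ≠ (p.getVert j).edge := by
    intro i j hij hj h
    rcases (dart_edge_eq_iff _ _).1 h with h | h
    · exact hC i j hij hj.le h
    · have := hD i j hij.le hj.le h
      omega
  let e : Fin p.length → G.edgeSet := fun i => ⟨(p.getVert i).edge, (p.getVert i).edge_mem⟩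
  have hadj : ∀ i j : Fin p.length, i < j → (H.Adj (e i) (e j) ↔ (cycleGraph p.length).Adj i j) := by
    intro i j hij
    have hij' : i.val < j.val := hij
    rw [cycleGraph_adj_iff_of_lt hij]
    constructor
    · intro h
      rcases adj_or_adj_symm hH h with h | h
      · have := hA i j hij'.le j.isLt.le h
        omega
      · have := hB i j hij'.le j.isLt.le h
        omega
    · rintro (h | ⟨h, h'⟩)
      · have := (hstep i i.isLt).1
        simpa only [e, h] using this
      · have := (hstep j j.isLt).1.symm
        simp only [h', hn, Dart.edge_symm] at this
        simpa only [e, h, h0] using this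
  refine (hc p.length hlen).false ⟨⟨e, ?_⟩, ?_⟩
  · intro i j h
    have h' : (p.getVert i).edge = (p.getVert j).edge := congrArg Subtype.val h
    rcases lt_trichotomy i j with hij | hij | hij
    · exact absurd h' (hne i j hij j.isLt)
    · exact hij
    · exact absurd h'.symm (hne j i hij i.isLt)
  · intro i j
    change H.Adj (e i) (e j) ↔ _
    rcases lt_trichotomy i j with hij | rfl | hij
    · exact hadj i j hij
    · simp
    · rw [H.adj_comm, (cycleGraph _).adj_comm]
      exact hadj j i hij

end elbowDartGraph

/-- A chordal subgraph of the line graph of a triangle-free graph consists of elbows of a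
single orientation. -/
lemma exists_orientation_isElbow {V : Type*} {G : SimpleGraph V} (hG : G.CliqueFree 3)
    {H : SimpleGraph G.edgeSet} (hH : H ≤ G.lineGraph) (hc : IsChordal H) :
    ∃ o : GraphOrientation G, ∀ x y z (hy : G.Adj x y) (hz : G.Adj x z),
      H.Adj ⟨s(x, y), hy⟩ ⟨s(x, z), hz⟩ → o.IsElbow x y z := by
  let c : G.Dart → (elbowDartGraph H).ConnectedComponent :=
    (elbowDartGraph H).connectedComponentMk
  let _ : LinearOrder (elbowDartGraph H).ConnectedComponent :=
    WellOrderingRel.isWellOrder.linearOrder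
  have hne : ∀ d, c d ≠ c d.symm := fun d h =>
    elbowDartGraph.not_reachable_symm hG hH hc d (ConnectedComponent.exact h)
  refine ⟨⟨fun u v => ∃ h : G.Adj u v, c ⟨(u, v), h⟩ < c ⟨(v, u), h.symm⟩,
    fun u v => ⟨fun h => ?_, ?_⟩, fun u v ⟨_, h⟩ ⟨_, h'⟩ => h.asymm h'⟩, fun x y z hy hz h => ?_⟩
  · exact (hne ⟨(u, v), h⟩).lt_or_gt.imp (⟨h, ·⟩) (⟨h.symm, ·⟩)
  · rintro (⟨h, -⟩ | ⟨h, -⟩)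
    exacts [h, h.symm]
  · have hd : (elbowDartGraph H).Adj ⟨(x, y), hy⟩ ⟨(x, z), hz⟩ := ⟨h, Or.inl rfl⟩
    have h1 : c ⟨(x, y), hy⟩ = c ⟨(x, z), hz⟩ := ConnectedComponent.sound hd.reachable
    have h2 : c ⟨(y, x), hy.symm⟩ = c ⟨(z, x), hz.symm⟩ :=
      ConnectedComponent.sound (elbowDartGraph.adj_symm hd).reachable
    rcases (hne ⟨(x, y), hy⟩).lt_or_gt with hlt | hlt
    · exact Or.inr ⟨⟨hy, hlt⟩, hz, h1 ▸ h2 ▸ hlt⟩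
    · exact Or.inl ⟨⟨hy.symm, hlt⟩, hz.symm, h1 ▸ h2 ▸ hlt⟩

lemma isChordal_fromEdgeSet_singleton {V : Type*} (e : Sym2 V) :
    IsChordal (fromEdgeSet {e}) := by
  refine fun n hn => ⟨fun φ => ?_⟩
  have key : ∀ i j : Fin n, i < j → j.val = i.val + 1 → s(φ i, φ j) = e := fun i j hij h =>
    ((fromEdgeSet_adj _).1 (φ.map_adj_iff.2 ((cycleGraph_adj_iff_of_lt hij).2 (Or.inl h)))).1
  have h1 := key ⟨0, by omega⟩ ⟨1, by omega⟩ (by simp) rfl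
  have h2 := key ⟨1, by omega⟩ ⟨2, by omega⟩ (by simp) rfl
  have h := φ.injective (Sym2.congr_right.1 ((Sym2.eq_swap.trans h1).trans h2.symm))
  simp at h

lemma exists_chordal_cover {V : Type*} [Finite V] (G : SimpleGraph V) :
    ∃ (k : ℕ) (f : Fin k → SimpleGraph V), (∀ i, IsChordal (f i)) ∧ (⨆ i, f i) = G := by
  obtain ⟨k, ⟨φ⟩⟩ := Finite.exists_equiv_fin G.edgeSet
  refine ⟨k, fun i => fromEdgeSet {(φ.symm i).val},
    fun i => isChordal_fromEdgeSet_singleton _, ?_⟩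
  rw [← fromEdgeSet_iUnion, φ.symm.surjective.iUnion_comp (fun e => {e.val}),
    Set.iUnion_of_singleton_coe, fromEdgeSet_edgeSet]

theorem stmt_0 {V : Type*} [Fintype V] (G : SimpleGraph V) (hG : G.CliqueFree 3) :
    elbowCoverNumber G ≤ chordalCoverNumber G.lineGraph := by
  obtain ⟨f, hf, hsup⟩ := Nat.sInf_mem (exists_chordal_cover G.lineGraph)
  have hle : ∀ i, f i ≤ G.lineGraph := fun i => hsup ▸ le_iSup f i
  choose o ho using fun i => exists_orientation_isElbow hG (hle i) (hf i)
  refine Nat.sInf_le ⟨o, fun x y z hy hz hyz => ?_⟩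
  have hadj : G.lineGraph.Adj ⟨s(x, y), hy⟩ ⟨s(x, z), hz⟩ :=
    lineGraph_adj_iff_exists.2 ⟨fun h => hyz (Sym2.congr_right.1 (congrArg Subtype.val h)),
      x, Sym2.mem_mk_left x y, Sym2.mem_mk_left x z⟩
  rw [← hsup, iSup_adj] at hadj
  obtain ⟨i, hi⟩ := hadj
  exact ⟨i, ho i x y z hy hz hi⟩
end

section
/- For every triangle-free simple graph G, the chain of inequalities cc(L(G)) ≤ τ(L(G)) ≤ eq(L(G)) ≤ 2·cc(L(G)) holds; in particular these three covering numbers of the line graph of a triangle-free graph are within a factor of 2 of each other. -/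
open SimpleGraph

section Cover

variable {V : Type*} {P Q : SimpleGraph V → Prop} {G : SimpleGraph V}

theorem coverNumber_le_card {ι : Type*} [Fintype ι] (f : ι → SimpleGraph V)
    (hP : ∀ i, P (f i)) (hG : ⨆ i, f i = G) : coverNumber P G ≤ Fintype.card ι :=
  Nat.sInf_le ⟨f ∘ (Fintype.equivFin ι).symm, fun _ ↦ hP _, by
    rw [← hG]; exact (Fintype.equivFin ι).symm.iSup_comp⟩

theorem exists_coverNumber
    (hne : ∃ k, ∃ f : Fin k → SimpleGraph V, (∀ i, P (f i)) ∧ ⨆ i, f i = G) :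
    ∃ f : Fin (coverNumber P G) → SimpleGraph V, (∀ i, P (f i)) ∧ ⨆ i, f i = G :=
  Nat.sInf_mem hne

theorem coverNumber_mono (hPQ : ∀ H, P H → Q H)
    (hne : ∃ k, ∃ f : Fin k → SimpleGraph V, (∀ i, P (f i)) ∧ ⨆ i, f i = G) :
    coverNumber Q G ≤ coverNumber P G := by
  obtain ⟨f, hf, hG⟩ := exists_coverNumber hne
  exact Nat.sInf_le ⟨f, fun i ↦ hPQ _ (hf i), hG⟩

theorem isEquivalenceGraph_edge (s t : V) : IsEquivalenceGraph (edge s t) := by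
  intro u v w
  simp only [edge_adj]
  grind

theorem exists_equivalenceGraph_cover [Finite V] (G : SimpleGraph V) :
    ∃ k, ∃ f : Fin k → SimpleGraph V, (∀ i, IsEquivalenceGraph (f i)) ∧ ⨆ i, f i = G := by
  let ι := {p : V × V // G.Adj p.1 p.2}
  refine ⟨Nat.card ι, fun i ↦ edge ((Finite.equivFin ι).symm i).1.1
    ((Finite.equivFin ι).symm i).1.2, fun i ↦ isEquivalenceGraph_edge _ _, ?_⟩
  rw [(Finite.equivFin ι).symm.iSup_comp (g := fun i : ι ↦ edge i.1.1 i.1.2)]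
  ext u v
  simp only [iSup_adj, edge_adj]
  constructor
  · rintro ⟨⟨⟨a, b⟩, h⟩, ⟨rfl, rfl⟩ | ⟨rfl, rfl⟩, -⟩
    · exact h
    · exact h.symm
  · exact fun h ↦ ⟨⟨(u, v), h⟩, Or.inl ⟨rfl, rfl⟩, h.ne⟩

end Cover

section Interval

variable {V : Type*} {G : SimpleGraph V}

theorem IsEquivalenceGraph.isIntervalGraph [Finite V] (hG : IsEquivalenceGraph G) :
    IsIntervalGraph G := by
  let s : Setoid V :=
    { r := fun u v ↦ u = v ∨ G.Adj u v
      iseqv :=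
        { refl := fun u ↦ Or.inl rfl
          symm := fun h ↦ h.imp Eq.symm Adj.symm
          trans := by
            rintro u v w (rfl | huv) (rfl | hvw)
            · exact Or.inl rfl
            · exact Or.inr hvw
            · exact Or.inr huv
            · exact (eq_or_ne u w).imp_right (hG u v w huv hvw) } }
  let φ : V → ℝ := fun v ↦ (Finite.equivFin (Quotient s) ⟦v⟧ : ℕ)
  have hφ (u v : V) : φ u = φ v ↔ u = v ∨ G.Adj u v := by
    simp only [φ, Nat.cast_inj, Fin.val_inj, EmbeddingLike.apply_eq_iff_eq]
    exact Quotient.eq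
  refine ⟨φ, φ, fun _ ↦ le_rfl, fun u v ↦ ?_⟩
  simp only [Set.Icc_self, Set.singleton_inter_nonempty, Set.mem_singleton_iff, hφ]
  exact ⟨fun h ↦ ⟨h.ne, Or.inr h⟩, fun h ↦ h.2.resolve_left h.1⟩

open Fin.CommRing in
theorem IsIntervalGraph.isChordal (hG : IsIntervalGraph G) : IsChordal G := by
  obtain ⟨a, b, hab, hadj⟩ := hG
  intro n hn
  obtain ⟨m, rfl⟩ : ∃ m, n = m + 4 := ⟨n - 4, by omega⟩
  refine ⟨fun f ↦ ?_⟩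
  obtain ⟨i, hi⟩ := Finite.exists_min fun i ↦ b (f i)
  have hmem (j : Fin (m + 4)) (h : (cycleGraph (m + 4)).Adj i j) :
      b (f i) ∈ Set.Icc (a (f j)) (b (f j)) := by
    obtain ⟨x, hx, hx'⟩ := ((hadj _ _).1 (f.map_adj_iff.2 h)).2
    exact ⟨hx'.1.trans hx.2, hi j⟩
  have hprev := hmem (i - 1) (cycleGraph_adj.2 (Or.inl (by ring)))
  have hnext := hmem (i + 1) (cycleGraph_adj.2 (Or.inr (by ring)))
  have h1 : (i + 1) - (i - 1) = 2 := by ring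
  have h2 : (i - 1) - (i + 1) = -2 := by ring
  have hval (k : ℕ) [k.AtLeastTwo] (hk : k < m + 4) :
      ((OfNat.ofNat k : Fin (m + 4)) : ℕ) = k :=
    Nat.mod_eq_of_lt hk
  have h3 : (2 : Fin (m + 4)) ≠ 1 := by
    rw [ne_eq, Fin.ext_iff, hval 2 (by omega)]
    simp
  have h4 : (-2 : Fin (m + 4)) ≠ 1 := by
    intro h
    have h0 : (3 : Fin (m + 4)) = 0 := by linear_combination -h
    rw [Fin.ext_iff, hval 3 (by omega)] at h0
    simp at h0
  have hne : i - 1 ≠ i + 1 := by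
    intro h
    have h0 : (2 : Fin (m + 4)) = 0 := by rw [← h1, h, sub_self]
    rw [Fin.ext_iff, hval 2 (by omega)] at h0
    simp at h0
  have hnadj := f.map_adj_iff.1
    ((hadj _ _).2 ⟨f.injective.ne hne, ⟨_, hprev, hnext⟩⟩)
  rw [cycleGraph_adj, h1, h2] at hnadj
  exact hnadj.elim h4 h3

end Interval

section Chordal

variable {V A : Type*} [AddCommGroup A] {G : SimpleGraph V}

/-- The sum of a function of ordered pairs along the steps of a walk. -/
def walkSum (c : V → V → A) {u v : V} (p : G.Walk u v) : A :=
  (p.darts.map fun d ↦ c d.fst d.snd).sum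

variable {c : V → V → A}

@[simp]
theorem walkSum_nil (u : V) : walkSum c (Walk.nil : G.Walk u u) = 0 := rfl

@[simp]
theorem walkSum_cons {u v w : V} (h : G.Adj u v) (p : G.Walk v w) :
    walkSum c (Walk.cons h p) = c u v + walkSum c p := by
  simp [walkSum]

@[simp]
theorem walkSum_append {u v w : V} (p : G.Walk u v) (q : G.Walk v w) :
    walkSum c (p.append q) = walkSum c p + walkSum c q := by
  simp [walkSum]

@[simp]
theorem walkSum_copy {u v u' v' : V} (p : G.Walk u v) (hu : u = u') (hv : v = v') :
    walkSum c (p.copy hu hv) = walkSum c p := by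
  subst hu hv; rfl

theorem walkSum_reverse (hc : ∀ u v, G.Adj u v → c v u = -c u v) {u v : V} (p : G.Walk u v) :
    walkSum c p.reverse = -walkSum c p := by
  induction p with
  | nil => simp
  | cons h p ih => simp [ih, hc _ _ h]

theorem exists_walk_split {u v : V} (p : G.Walk u v) {i j : ℕ} (hij : i ≤ j)
    (hj : j ≤ p.length) :
    ∃ (q : G.Walk u (p.getVert i)) (r : G.Walk (p.getVert i) (p.getVert j))
      (s : G.Walk (p.getVert j) v), q.length = i ∧ r.length = j - i ∧
      s.length = p.length - j ∧ p = q.append (r.append s) := by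
  have hv : (p.drop i).getVert (j - i) = p.getVert j := by
    rw [Walk.drop_getVert, Nat.add_sub_cancel' hij]
  refine ⟨p.take i, ((p.drop i).take (j - i)).copy rfl hv,
    ((p.drop i).drop (j - i)).copy hv rfl, ?_, ?_, ?_, ?_⟩
  · simp; omega
  · simp; omega
  · simp; omega
  · rw [Walk.append_copy_copy, Walk.append_take_drop_eq, Walk.copy_rfl_rfl,
      Walk.append_take_drop_eq]

/-- A closed walk without repetitions and chords traces an induced cycle. -/
def cycleGraphEmbeddingOfGetVert {u : V} (p : G.Walk u u)
    (hinj : ∀ i j, i < j → j < p.length → p.getVert i ≠ p.getVert j)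
    (hchord : ∀ i j, i + 2 ≤ j → j - i + 2 ≤ p.length → j < p.length →
      ¬ G.Adj (p.getVert i) (p.getVert j)) :
    cycleGraph p.length ↪g G where
  toFun i := p.getVert i
  inj' i j h := by
    rcases lt_trichotomy i j with hij | hij | hij
    · exact (hinj _ _ hij j.2 h).elim
    · exact hij
    · exact (hinj _ _ hij i.2 h.symm).elim
  map_rel_iff' := by
    have key (i j : Fin p.length) (hij : i < j) :
        G.Adj (p.getVert i) (p.getVert j) ↔ (cycleGraph p.length).Adj i j := by
      have h1 : (j - i).val = j.val - i.val := Fin.sub_val_of_le hij.le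
      have h2 : (i - j).val = p.length + i.val - j.val := Fin.coe_sub_iff_lt.2 hij
      have hij' : i.val < j.val := hij
      have hj := j.2
      rw [cycleGraph_adj', h1, h2]
      constructor
      · intro h
        by_contra hne
        exact hchord i j (by omega) (by omega) j.2 h
      · rintro (h | h)
        · have hi : i.val = 0 := by omega
          have h' := p.adj_getVert_succ hj
          rw [show j.val + 1 = p.length by omega, Walk.getVert_length] at h'
          rw [hi, Walk.getVert_zero]
          exact h'.symm
        · have h' := p.adj_getVert_succ i.2
          rwa [show i.val + 1 = j.val by omega] at h'
    intro i j
    change G.Adj (p.getVert i) (p.getVert j) ↔ _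
    rcases lt_trichotomy i j with hij | rfl | hij
    · exact key i j hij
    · simp
    · rw [G.adj_comm, (cycleGraph _).adj_comm]
      exact key j i hij

theorem IsChordal.walkSum_eq_zero (hG : IsChordal G) (hc : ∀ u v, G.Adj u v → c v u = -c u v)
    (htri : ∀ u v w, G.Adj u v → G.Adj v w → G.Adj w u → c u v + c v w + c w u = 0)
    {u : V} (p : G.Walk u u) : walkSum c p = 0 := by
  induction hn : p.length using Nat.strong_induction_on generalizing u with
  | _ n ih =>
  have ih' {v : V} (q : G.Walk v v) (h : q.length < p.length) : walkSum c q = 0 :=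
    ih _ (hn ▸ h) q rfl
  clear ih
  by_cases h4 : 3 < p.length
  · by_contra hp
    refine (hG _ h4).false (cycleGraphEmbeddingOfGetVert p ?_ ?_)
    · intro i j hij hj h
      obtain ⟨q, r, s, hq, hr, hs, hqrs⟩ := exists_walk_split p hij.le hj.le
      have hr0 := ih' (r.copy rfl h.symm) (by simp; omega)
      have hqs := ih' (q.append (s.copy h.symm rfl)) (by simp; omega)
      refine hp ?_
      rw [hqrs]
      simp only [walkSum_append, walkSum_copy] at hr0 hqs ⊢
      rw [hr0, zero_add, hqs]
    · intro i j hij hl hj h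
      obtain ⟨q, r, s, hq, hr, hs, hqrs⟩ := exists_walk_split p (by omega : i ≤ j) hj.le
      have hr0 := ih' (Walk.cons h.symm r) (by simp; omega)
      have hqs := ih' (q.append (Walk.cons h s)) (by simp; omega)
      refine hp ?_
      rw [hqrs]
      simp only [walkSum_append, walkSum_cons, hc _ _ h] at hr0 hqs ⊢
      rw [← neg_add_eq_zero.1 hr0]
      exact hqs
  · match p, h4 with
    | .nil, _ => rfl
    | .cons h .nil, _ => exact (h.ne rfl).elim
    | .cons h (.cons h' .nil), _ => simp [hc _ _ h]
    | .cons h (.cons h' (.cons h'' .nil)), _ =>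
      simpa [add_assoc] using htri _ _ _ h h' h''
    | .cons _ (.cons _ (.cons _ (.cons _ _))), h4 => simp at h4

theorem IsChordal.exists_potential (hG : IsChordal G)
    (hc : ∀ u v, G.Adj u v → c v u = -c u v)
    (htri : ∀ u v w, G.Adj u v → G.Adj v w → G.Adj w u → c u v + c v w + c w u = 0) :
    ∃ t : V → A, ∀ u v, G.Adj u v → t v = t u + c u v := by
  let r : V → V := fun v ↦ (G.connectedComponentMk v).out
  have hr (v : V) : G.Reachable (r v) v := ConnectedComponent.exact (Quot.out_eq _)
  choose p _ using fun v ↦ (hr v).exists_walk_length_eq_dist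
  refine ⟨fun v ↦ walkSum c (p v), fun u v h ↦ ?_⟩
  have huv : r v = r u := congrArg Quot.out (ConnectedComponent.sound h.symm.reachable)
  have h0 := hG.walkSum_eq_zero hc htri
    ((p u).append (Walk.cons h ((p v).reverse.copy rfl huv)))
  simp only [walkSum_append, walkSum_cons, walkSum_copy, walkSum_reverse hc] at h0
  rw [← add_assoc] at h0
  exact (add_neg_eq_zero.1 h0).symm

end Chordal

section LineGraph

variable {V : Type*} {G : SimpleGraph V}

/-- The graph joining two edges of `G` when `f` selects a common endpoint for them. -/
def selectGraph (f : G.edgeSet → V) : SimpleGraph G.edgeSet where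
  Adj e e' := e ≠ e' ∧ f e = f e'
  symm := ⟨fun _ _ h ↦ ⟨h.1.symm, h.2.symm⟩⟩
  loopless := ⟨fun _ h ↦ h.1 rfl⟩

theorem isEquivalenceGraph_selectGraph (f : G.edgeSet → V) :
    IsEquivalenceGraph (selectGraph f) :=
  fun _ _ _ h h' hne ↦ ⟨hne, h.2.trans h'.2⟩

theorem selectGraph_le_lineGraph {f : G.edgeSet → V} (hf : ∀ e : G.edgeSet, f e ∈ (e : Sym2 V)) :
    selectGraph f ≤ G.lineGraph :=
  fun e e' h ↦ lineGraph_adj_iff_exists.2 ⟨h.1, f e, hf e, h.2 ▸ hf e'⟩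

theorem exists_mem_of_lineGraph_triangle (hG : G.CliqueFree 3) {e f g : G.edgeSet}
    (hef : G.lineGraph.Adj e f) (hfg : G.lineGraph.Adj f g) (hge : G.lineGraph.Adj g e) :
    ∃ x, x ∈ (e : Sym2 V) ∧ x ∈ (f : Sym2 V) ∧ x ∈ (g : Sym2 V) := by
  classical
  obtain ⟨-, x, hxe, hxf⟩ := lineGraph_adj_iff_exists.1 hef
  obtain ⟨-, y, hyf, hyg⟩ := lineGraph_adj_iff_exists.1 hfg
  obtain ⟨-, z, hzg, hze⟩ := lineGraph_adj_iff_exists.1 hge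
  have key {a b : V} {d : G.edgeSet} (hab : a ≠ b) (ha : a ∈ (d : Sym2 V))
      (hb : b ∈ (d : Sym2 V)) : G.Adj a b := by
    rw [← mem_edgeSet, ← (Sym2.mem_and_mem_iff hab).1 ⟨ha, hb⟩]
    exact d.2
  by_cases hxy : x = y
  · exact ⟨x, hxe, hxf, hxy ▸ hyg⟩
  by_cases hyz : y = z
  · exact ⟨y, hyz ▸ hze, hyf, hyg⟩
  by_cases hxz : x = z
  · exact ⟨x, hxe, hxf, hxz ▸ hzg⟩
  exact (hG {x, y, z} (is3Clique_triple_iff.2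
    ⟨key hxy hxf hyf, key hxz hxe hze, key hyz hyg hzg⟩)).elim

theorem exists_selection_of_isChordal (hG : G.CliqueFree 3) {H : SimpleGraph G.edgeSet}
    (hH : IsChordal H) (hHG : H ≤ G.lineGraph) :
    ∃ f g : G.edgeSet → V, (∀ e : G.edgeSet, f e ∈ (e : Sym2 V)) ∧ (∀ e : G.edgeSet, g e ∈ (e : Sym2 V)) ∧
      H ≤ selectGraph f ⊔ selectGraph g := by
  classical
  let a : G.edgeSet → V := fun e ↦ (Quot.out (e : Sym2 V)).1
  let b : G.edgeSet → V := fun e ↦ (Quot.out (e : Sym2 V)).2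
  have ha (e : G.edgeSet) : a e ∈ (e : Sym2 V) := Sym2.out_fst_mem _
  have hb (e : G.edgeSet) : b e ∈ (e : Sym2 V) := Sym2.out_snd_mem _
  have heq (e : G.edgeSet) : (e : Sym2 V) = s(a e, b e) := (Quot.out_eq (e : Sym2 V)).symm
  have hne (e : G.edgeSet) : a e ≠ b e := by
    have h := e.2
    rw [heq e] at h
    exact h.ne
  have hmem (e : G.edgeSet) (x : V) (hx : x ∈ (e : Sym2 V)) : x = a e ∨ x = b e := by
    rwa [heq e, Sym2.mem_iff] at hx
  have huniq {e f : G.edgeSet} (hef : e ≠ f) {x y : V} (hxe : x ∈ (e : Sym2 V))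
      (hxf : x ∈ (f : Sym2 V)) (hye : y ∈ (e : Sym2 V)) (hyf : y ∈ (f : Sym2 V)) : x = y := by
    by_contra hxy
    exact hef (Subtype.ext (((Sym2.mem_and_mem_iff hxy).1 ⟨hxe, hye⟩).trans
      ((Sym2.mem_and_mem_iff hxy).1 ⟨hxf, hyf⟩).symm))
  let c : G.edgeSet → G.edgeSet → ZMod 2 := fun e f ↦ if a e = a f ∨ b e = b f then 0 else 1
  have hc {e f : G.edgeSet} (hef : e ≠ f) {x : V} (hxe : x ∈ (e : Sym2 V))
      (hxf : x ∈ (f : Sym2 V)) :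
      c e f = (if x = a e then 1 else 0) + (if x = a f then 1 else 0) := by
    have h1 : a e = a f → x = a e := fun h ↦ huniq hef hxe hxf (ha e) (h ▸ ha f)
    have h2 : b e = b f → x = b e := fun h ↦ huniq hef hxe hxf (hb e) (h ▸ hb f)
    have h3 := hmem e x hxe
    have h4 := hmem f x hxf
    have h5 := hne e
    have h6 := hne f
    have h7 : (1 : ZMod 2) + 1 = 0 := rfl
    simp only [c]
    grind
  obtain ⟨t, ht⟩ := hH.exists_potential (c := c)
    (fun e f _ ↦ by rw [ZMod.neg_eq_self_mod_two]; simp only [c, eq_comm])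
    (fun e f g hef hfg hge ↦ by
      obtain ⟨x, hxe, hxf, hxg⟩ :=
        exists_mem_of_lineGraph_triangle hG (hHG hef) (hHG hfg) (hHG hge)
      rw [hc hef.ne hxe hxf, hc hfg.ne hxf hxg, hc hge.ne hxg hxe]
      split_ifs <;> rfl)
  refine ⟨fun e ↦ if t e = 0 then a e else b e, fun e ↦ if t e = 0 then b e else a e,
    fun e ↦ by dsimp only; split_ifs; exacts [ha e, hb e],
    fun e ↦ by dsimp only; split_ifs; exacts [hb e, ha e], fun e f hef ↦ ?_⟩
  obtain ⟨-, x, hxe, hxf⟩ := lineGraph_adj_iff_exists.1 (hHG hef)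
  have hxe' := hmem e x hxe
  have hxf' := hmem f x hxf
  have htef := ht e f hef
  have hZ (z : ZMod 2) : z = 0 ∨ z = 1 := by revert z; decide
  have h10 : (1 : ZMod 2) ≠ 0 := by decide
  have h11 : (1 : ZMod 2) + 1 = 0 := rfl
  have hte := hZ (t e)
  suffices h : (if t e = 0 then a e else b e) = (if t f = 0 then a f else b f) ∨
      (if t e = 0 then b e else a e) = (if t f = 0 then b f else a f) from
    h.imp (⟨hef.ne, ·⟩) (⟨hef.ne, ·⟩)
  simp only [c] at htef
  grind

end LineGraph

theorem stmt_2 {V : Type*} [Fintype V] (G : SimpleGraph V) (hG : G.CliqueFree 3) :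
    chordalCoverNumber G.lineGraph ≤ trackNumber G.lineGraph ∧
    trackNumber G.lineGraph ≤ eqCoverNumber G.lineGraph ∧
    eqCoverNumber G.lineGraph ≤ 2 * chordalCoverNumber G.lineGraph := by
  obtain ⟨k, F, hF, hFG⟩ := exists_equivalenceGraph_cover G.lineGraph
  refine ⟨coverNumber_mono (fun _ ↦ IsIntervalGraph.isChordal)
      ⟨k, F, fun i ↦ (hF i).isIntervalGraph, hFG⟩,
    coverNumber_mono (fun _ ↦ IsEquivalenceGraph.isIntervalGraph) ⟨k, F, hF, hFG⟩, ?_⟩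
  obtain ⟨H, hH, hHG⟩ := exists_coverNumber (P := IsChordal) (G := G.lineGraph)
    ⟨k, F, fun i ↦ (hF i).isIntervalGraph.isChordal, hFG⟩
  choose f g hf hg hfg using fun i ↦
    exists_selection_of_isChordal hG (hH i) (hHG ▸ le_iSup H i)
  refine (coverNumber_le_card (fun i : Bool × Fin (coverNumber IsChordal G.lineGraph) ↦
    selectGraph (if i.1 then f i.2 else g i.2))
    (fun i ↦ isEquivalenceGraph_selectGraph _) (le_antisymm ?_ ?_)).trans_eq (by simp [chordalCoverNumber])
  · refine iSup_le fun ⟨i, j⟩ ↦ selectGraph_le_lineGraph ?_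
    cases i
    · exact hg j
    · exact hf j
  · refine hHG.ge.trans <| iSup_le fun j ↦ (hfg j).trans (sup_le ?_ ?_)
    · exact le_iSup_of_le (true, j) le_rfl
    · exact le_iSup_of_le (false, j) le_rfl
end

section
/- For every simple graph G, inelb(G) ≤ 3·eq(L(G)): from any cover of L(G) by k equivalence graphs one can construct an in-elbow cover of G using 3k orientations. -/
open SimpleGraph

/-- Among pairwise intersecting edges, at most three vertices are shared by two distinct edges. -/
theorem exists_three_centers {V : Type*} [Nonempty V] (C : Set (Sym2 V))
    (hC : ∀ e ∈ C, ∀ e' ∈ C, ∃ v, v ∈ e ∧ v ∈ e') :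
    ∃ p : Fin 3 → V, ∀ x y z, s(x, y) ∈ C → s(x, z) ∈ C → y ≠ z → ∃ i, p i = x := by
  by_cases h : ∃ x y z, s(x, y) ∈ C ∧ s(x, z) ∈ C ∧ y ≠ z
  · obtain ⟨x, y, z, hy, hz, hyz⟩ := h
    refine ⟨![x, y, z], fun w u u' hu hu' huu' => ?_⟩
    by_contra! hw
    have hwx : x ≠ w := hw 0
    have hwy : y ≠ w := hw 1
    have hwz : z ≠ w := hw 2
    have eq_center : ∀ t, s(w, t) ∈ C → t = x := by
      intro t ht
      obtain ⟨a, ha, ha'⟩ := hC _ ht _ hy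
      obtain ⟨b, hb, hb'⟩ := hC _ ht _ hz
      simp only [Sym2.mem_iff] at ha ha' hb hb'
      grind
    exact huu' ((eq_center u hu).trans (eq_center u' hu').symm)
  · obtain ⟨v⟩ := ‹Nonempty V›
    exact ⟨fun _ => v, fun x y z hy hz hyz => (h ⟨x, y, z, hy, hz, hyz⟩).elim⟩

/-- The orientation directing every edge towards a chosen endpoint. -/
def GraphOrientation.ofHead {V : Type*} {G : SimpleGraph V} (head : G.edgeSet → V)
    (mem : ∀ e, head e ∈ e.1) : GraphOrientation G where
  dir u v := ∃ e : G.edgeSet, e.1 = s(u, v) ∧ head e = v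
  adj_iff u v := by
    constructor
    · intro huv
      have hm := mem ⟨s(u, v), huv⟩
      rcases Sym2.mem_iff.1 hm with h | h
      · exact Or.inr ⟨_, Sym2.eq_swap, h⟩
      · exact Or.inl ⟨_, rfl, h⟩
    · rintro (⟨e, he, -⟩ | ⟨e, he, -⟩)
      · have := e.2
        rwa [he] at this
      · have := e.2
        rw [he] at this
        exact G.adj_symm this
  asymm := by
    rintro u v ⟨e, he, hv⟩ ⟨e', he', hu⟩
    have hee' : e = e' := Subtype.ext (he.trans (Sym2.eq_swap.trans he'.symm))
    subst hee'
    have hadj := e.2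
    rw [he] at hadj
    exact G.ne_of_adj hadj (hu.symm.trans hv)

/-- Three orientations suffice to cover the pairs of edges adjacent in an equivalence subgraph
of the line graph. -/
theorem IsEquivalenceGraph.exists_three_orientations {V : Type*} {G : SimpleGraph V}
    {F : SimpleGraph G.edgeSet} (hF : IsEquivalenceGraph F) (hle : F ≤ G.lineGraph) :
    ∃ o : Fin 3 → GraphOrientation G, ∀ x y z (hy : G.Adj x y) (hz : G.Adj x z),
      F.Adj ⟨s(x, y), hy⟩ ⟨s(x, z), hz⟩ → ∃ i, (o i).IsInElbow x y z := by
  classical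
  let S : Setoid G.edgeSet :=
    { r := fun e e' => e = e' ∨ F.Adj e e'
      iseqv :=
        { refl := fun _ => Or.inl rfl
          symm := by
            rintro e e' (h | h)
            · exact Or.inl h.symm
            · exact Or.inr h.symm
          trans := by
            rintro e e' e'' (rfl | h) (rfl | h')
            · exact Or.inl rfl
            · exact Or.inr h'
            · exact Or.inr h
            · by_cases hne : e = e''
              · exact Or.inl hne
              · exact Or.inr (hF _ _ _ h h' hne) } }
  have centers : ∀ q : Quotient S, ∃ p : Fin 3 → V, ∀ x y z (hy : G.Adj x y) (hz : G.Adj x z),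
      Quotient.mk S ⟨s(x, y), hy⟩ = q → Quotient.mk S ⟨s(x, z), hz⟩ = q → y ≠ z →
      ∃ i, p i = x := by
    intro q
    have : Nonempty V := ⟨q.out.1.out.1⟩
    obtain ⟨p, hp⟩ := exists_three_centers {e | ∃ he : e ∈ G.edgeSet, Quotient.mk S ⟨e, he⟩ = q} (by
      rintro e ⟨he, heq⟩ e' ⟨he', heq'⟩
      rcases Quotient.exact (heq.trans heq'.symm) with h | h
      · obtain rfl : e = e' := congrArg Subtype.val h
        exact ⟨_, e.out_fst_mem, e.out_fst_mem⟩
      · obtain ⟨-, v, hv, hv'⟩ := hle h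
        exact ⟨v, hv, hv'⟩)
    exact ⟨p, fun x y z hy hz hqy hqz => hp x y z ⟨hy, hqy⟩ ⟨hz, hqz⟩⟩
  choose p hp using centers
  let head (i : Fin 3) (e : G.edgeSet) : V :=
    if p (Quotient.mk S e) i ∈ e.1 then p (Quotient.mk S e) i else e.1.out.1
  have head_mem : ∀ i e, head i e ∈ e.1 := by
    intro i e
    by_cases h : p (Quotient.mk S e) i ∈ e.1
    · simpa only [head, if_pos h] using h
    · simpa only [head, if_neg h] using e.1.out_fst_mem
  refine ⟨fun i => .ofHead (head i) (head_mem i), fun x y z hy hz hyz => ?_⟩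
  have hq : Quotient.mk S ⟨s(x, y), hy⟩ = Quotient.mk S ⟨s(x, z), hz⟩ := Quotient.sound (Or.inr hyz)
  have hne : y ≠ z := by
    rintro rfl
    exact F.ne_of_adj hyz rfl
  obtain ⟨i, hi⟩ := hp _ x y z hy hz rfl hq.symm hne
  refine ⟨i, ⟨⟨s(x, y), hy⟩, Sym2.eq_swap, ?_⟩, ⟨⟨s(x, z), hz⟩, Sym2.eq_swap, ?_⟩⟩
  · simp [head, hi]
  · simp [head, ← hq, hi]

/-- Every finite graph is a union of finitely many equivalence graphs. -/
theorem exists_equivalence_cover {W : Type*} [Finite W] (H : SimpleGraph W) :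
    ∃ (k : ℕ) (f : Fin k → SimpleGraph W), (∀ i, IsEquivalenceGraph (f i)) ∧ (⨆ i, f i) = H := by
  obtain ⟨k, ⟨φ⟩⟩ := Finite.exists_equiv_fin H.edgeSet
  refine ⟨k, fun i => fromEdgeSet {(φ.symm i).1}, fun i u v w huv hvw huw => ?_, ?_⟩
  · simp only [fromEdgeSet_adj, Set.mem_singleton_iff] at huv hvw
    have h := huv.1.trans hvw.1.symm
    rw [Sym2.eq_iff] at h
    grind
  · ext u v
    simp only [iSup_adj, fromEdgeSet_adj, Set.mem_singleton_iff]
    constructor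
    · rintro ⟨i, h, -⟩
      have := (φ.symm i).2
      rwa [← h] at this
    · intro h
      exact ⟨φ ⟨s(u, v), h⟩, by simp, h.ne⟩

theorem stmt_7 {V : Type*} [Fintype V] (G : SimpleGraph V) :
    inElbowCoverNumber G ≤ 3 * eqCoverNumber G.lineGraph := by
  obtain ⟨f, hf, hsup⟩ := Nat.sInf_mem (exists_equivalence_cover G.lineGraph)
  have hle : ∀ i, f i ≤ G.lineGraph := fun i => hsup ▸ le_iSup f i
  choose o ho using fun i => (hf i).exists_three_orientations (hle i)
  refine Nat.sInf_le ⟨fun j => o (finProdFinEquiv.symm j).2 (finProdFinEquiv.symm j).1,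
    fun x y z hy hz hyz => ?_⟩
  have hadj : G.lineGraph.Adj ⟨s(x, y), hy⟩ ⟨s(x, z), hz⟩ :=
    ⟨fun h => hyz (Sym2.congr_right.1 (congrArg Subtype.val h)), x, by simp, by simp⟩
  rw [← hsup, iSup_adj] at hadj
  obtain ⟨i, hi⟩ := hadj
  obtain ⟨j, hj⟩ := ho i x y z hy hz hi
  exact ⟨finProdFinEquiv (j, i), by simpa using hj⟩
end

section
/- For every simple graph G, eq(L(G)) ≤ 2·elb(G); this follows since inelb(G) ≤ 2·elb(G) and eq(L(G)) ≤ inelb(G). -/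
open SimpleGraph

namespace GraphOrientation

variable {V : Type*} {G : SimpleGraph V}

/-- The orientation with every edge reversed. -/
def reverse (o : GraphOrientation G) : GraphOrientation G where
  dir u v := o.dir v u
  adj_iff u v := (o.adj_iff u v).trans or_comm
  asymm u v h := o.asymm v u h

/-- The orientation directing each edge towards its endpoint of larger rank. -/
def ofRank (G : SimpleGraph V) (r : V → ℕ) (hr : Function.Injective r) :
    GraphOrientation G where
  dir u v := G.Adj u v ∧ r u < r v
  adj_iff u v := by
    constructor
    · intro h
      rcases lt_or_gt_of_ne (hr.ne h.ne) with h' | h'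
      · exact Or.inl ⟨h, h'⟩
      · exact Or.inr ⟨h.symm, h'⟩
    · rintro (h | h)
      · exact h.1
      · exact h.1.symm
  asymm u v h h' := lt_asymm h.2 h'.2

/-- The vertex `x` is the head of the edge `e`. -/
def IsHead (o : GraphOrientation G) (e : G.edgeSet) (x : V) : Prop :=
  ∃ y, o.dir y x ∧ (e : Sym2 V) = s(y, x)

theorem IsHead.unique {o : GraphOrientation G} {e : G.edgeSet} {x x' : V}
    (h : o.IsHead e x) (h' : o.IsHead e x') : x = x' := by
  obtain ⟨y, hy, he⟩ := h
  obtain ⟨y', hy', he'⟩ := h'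
  rcases Sym2.eq_iff.1 (he.symm.trans he') with ⟨-, h⟩ | ⟨rfl, rfl⟩
  · exact h
  · exact (o.asymm _ _ hy hy').elim

/-- The graph on the edges of `G` joining distinct edges with a common head. -/
def headGraph (o : GraphOrientation G) : SimpleGraph G.edgeSet where
  Adj e e' := e ≠ e' ∧ ∃ x, o.IsHead e x ∧ o.IsHead e' x
  symm := ⟨fun _ _ ⟨hne, x, h, h'⟩ => ⟨hne.symm, x, h', h⟩⟩
  loopless := ⟨fun _ h => h.1 rfl⟩

theorem isEquivalenceGraph_headGraph (o : GraphOrientation G) :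
    IsEquivalenceGraph o.headGraph := by
  rintro e₁ e₂ e₃ ⟨-, x, h₁, h₂⟩ ⟨-, y, h₂', h₃⟩ hne
  obtain rfl := h₂.unique h₂'
  exact ⟨hne, x, h₁, h₃⟩

theorem headGraph_le_lineGraph (o : GraphOrientation G) : o.headGraph ≤ G.lineGraph := by
  rintro e e' ⟨hne, x, ⟨y, -, he⟩, ⟨z, -, he'⟩⟩
  exact lineGraph_adj_iff_exists.2 ⟨hne, x, by simp [he], by simp [he']⟩

end GraphOrientation

open GraphOrientation

theorem iSup_headGraph_eq_lineGraph {V ι : Type*} {G : SimpleGraph V}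
    (f : ι → GraphOrientation G)
    (hf : ∀ x y z, G.Adj x y → G.Adj x z → y ≠ z → ∃ i, (f i).IsInElbow x y z) :
    ⨆ i, (f i).headGraph = G.lineGraph := by
  refine le_antisymm (iSup_le fun i => (f i).headGraph_le_lineGraph) ?_
  rintro ⟨e, he⟩ ⟨e', he'⟩ h
  obtain ⟨hne, x, hx, hx'⟩ := lineGraph_adj_iff_exists.1 h
  obtain ⟨y, rfl⟩ := Sym2.mem_iff_exists.1 hx
  obtain ⟨z, rfl⟩ := Sym2.mem_iff_exists.1 hx'
  obtain ⟨i, hi, hi'⟩ := hf x y z he he' (by rintro rfl; exact hne rfl)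
  rw [SimpleGraph.iSup_adj]
  exact ⟨i, hne, x, ⟨y, hi, Sym2.eq_swap⟩, ⟨z, hi', Sym2.eq_swap⟩⟩

theorem exists_inElbowCover {V : Type*} [Fintype V] (G : SimpleGraph V) :
    ∃ k, ∃ f : Fin k → GraphOrientation G,
      ∀ x y z, G.Adj x y → G.Adj x z → y ≠ z → ∃ i, (f i).IsInElbow x y z := by
  classical
  let e := Fintype.equivFin V
  let r (x v : V) : ℕ := if v = x then Fintype.card V else e v
  have hlt (x : V) {v : V} (hv : v ≠ x) : r x v < r x x := by
    simp [r, hv]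
  have hr (x : V) : Function.Injective (r x) := by
    intro u v h
    by_cases hu : u = x <;> by_cases hv : v = x
    · exact hu.trans hv.symm
    · exact ((hlt x hv).ne (by rw [← h, hu])).elim
    · exact ((hlt x hu).ne (by rw [h, hv])).elim
    · simpa [r, hu, hv, Fin.val_inj] using h
  refine ⟨Fintype.card V, fun i => ofRank G (r (e.symm i)) (hr _), fun x y z hy hz _ => ?_⟩
  refine ⟨e x, ?_⟩
  simp only [Equiv.symm_apply_apply]
  exact ⟨⟨hy.symm, hlt x hy.ne'⟩, ⟨hz.symm, hlt x hz.ne'⟩⟩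

theorem eqCoverNumber_lineGraph_le_inElbowCoverNumber {V : Type*} [Fintype V]
    (G : SimpleGraph V) : eqCoverNumber G.lineGraph ≤ inElbowCoverNumber G := by
  obtain ⟨f, hf⟩ := Nat.sInf_mem (exists_inElbowCover G)
  exact Nat.sInf_le ⟨fun i => (f i).headGraph, fun i => (f i).isEquivalenceGraph_headGraph,
    iSup_headGraph_eq_lineGraph f hf⟩

theorem inElbowCoverNumber_le_two_mul_elbowCoverNumber {V : Type*} [Fintype V]
    (G : SimpleGraph V) : inElbowCoverNumber G ≤ 2 * elbowCoverNumber G := by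
  have hne : {k | ∃ f : Fin k → GraphOrientation G,
      ∀ x y z, G.Adj x y → G.Adj x z → y ≠ z → ∃ i, (f i).IsElbow x y z}.Nonempty := by
    obtain ⟨k, f, hf⟩ := exists_inElbowCover G
    exact ⟨k, f, fun x y z hy hz h => (hf x y z hy hz h).imp fun _ => Or.inl⟩
  obtain ⟨f, hf⟩ := Nat.sInf_mem hne
  let g (p : Fin 2 × Fin (elbowCoverNumber G)) : GraphOrientation G :=
    if p.1 = 0 then f p.2 else (f p.2).reverse
  refine Nat.sInf_le ⟨fun i => g (finProdFinEquiv.symm i), fun x y z hy hz h => ?_⟩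
  obtain ⟨i, hi | hi⟩ := hf x y z hy hz h
  · refine ⟨finProdFinEquiv (0, i), ?_⟩
    simp only [Equiv.symm_apply_apply, g, if_true]
    exact hi
  · refine ⟨finProdFinEquiv (1, i), ?_⟩
    simp only [Equiv.symm_apply_apply, g, one_ne_zero, if_false]
    exact hi

theorem stmt_9 {V : Type*} [Fintype V] (G : SimpleGraph V) :
    eqCoverNumber G.lineGraph ≤ 2 * elbowCoverNumber G :=
  (eqCoverNumber_lineGraph_le_inElbowCoverNumber G).trans
    (inElbowCoverNumber_le_two_mul_elbowCoverNumber G)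
end

section
/- For a family 𝒢 of simple graphs, the set {τ(L(G)) : G ∈ 𝒢} of track numbers of the line graphs is bounded if and only if the set {χ(G) : G ∈ 𝒢} of chromatic numbers is bounded. -/
open SimpleGraph

/-- A relation that descends along a well-founded one and in which every element has at most one
predecessor admits a proper two-colouring. -/
theorem exists_bool_coloring_of_unique_pred {E : Type*} [Preorder E] [WellFoundedLT E]
    (P : E → E → Prop) (hlt : ∀ f e, P f e → f < e)
    (huniq : ∀ e f f', P f e → P f' e → f = f') :
    ∃ c : E → Bool, ∀ f e, P f e → c f ≠ c e := by
  classical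
  let F : ∀ e : E, (∀ f, f < e → Bool) → Bool :=
    fun e rec => decide (∃ f, ∃ h : P f e, rec f (hlt f e h) = false)
  let c : E → Bool := (wellFounded_lt (α := E)).fix F
  have hc : ∀ e, c e = decide (∃ f, ∃ _ : P f e, c f = false) := fun e =>
    (wellFounded_lt (α := E)).fix_eq F e
  refine ⟨c, fun f e h heq => ?_⟩
  have he := hc e
  cases hf : c f with
  | false =>
    rw [← heq, hf] at he
    simp only [exists_prop, false_eq_decide_iff, not_exists, not_and] at he
    exact he f h hf
  | true =>
    rw [← heq, hf] at he
    simp only [exists_prop, true_eq_decide_iff] at he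
    obtain ⟨f', h', hf'⟩ := he
    rw [huniq e f f' h h', hf'] at hf
    cases hf

/-- Represent edges of an ordered graph by their lower and upper endpoints `lo` and `hi`, and attach
to each an interval so that intersecting intervals belong to edges with a common endpoint. Then
eight colours suffice to distinguish consecutive edges whose intervals intersect. -/
theorem exists_coloring_of_intervals {E V : Type*} [Finite E] [LinearOrder V]
    (lo hi : E → V) (hlohi : ∀ e, lo e < hi e)
    (hinj : ∀ e f, lo e = lo f → hi e = hi f → e = f) (a b : E → ℝ)
    (hmeet : ∀ e f t, a e ≤ t → t ≤ b e → a f ≤ t → t ≤ b f →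
      lo e = lo f ∨ lo e = hi f ∨ hi e = lo f ∨ hi e = hi f) :
    ∃ c : E → Bool × Bool × Bool, ∀ e f, hi e = lo f →
      (Set.Icc (a e) (b e) ∩ Set.Icc (a f) (b f)).Nonempty → c e ≠ c f := by
  classical
  let idx : E ≃ Fin (Nat.card E) := Finite.equivFin E
  let _ : LinearOrder E := LinearOrder.lift' (fun e => toLex (a e, idx e))
    (fun e f h => idx.injective (Prod.ext_iff.1 (toLex.injective h)).2)
  have ha : ∀ e f : E, e < f → a e ≤ a f := fun e f h => by
    have h' : toLex (a e, idx e) < toLex (a f, idx f) := h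
    rw [Prod.Lex.lt_iff] at h'
    rcases h' with h' | h'
    · exact h'.le
    · exact h'.1.le
  let Alive : E → E → Prop := fun f e => a f ≤ a e ∧ a e ≤ b f
  let up : E → Prop := fun e => ∀ f, Alive f e → hi e = lo f ∨ hi e = hi f
  let down : E → Prop := fun e => ∀ f, Alive f e → lo e = lo f ∨ lo e = hi f
  have hclique : ∀ e f g, Alive f e → Alive g e →
      lo f = lo g ∨ lo f = hi g ∨ hi f = lo g ∨ hi f = hi g :=
    fun e f g hf hg => hmeet f g (a e) hf.1 hf.2 hg.1 hg.2
  let P : E → E → Prop := fun f e => f < e ∧ Alive f e ∧ a e ≤ b e ∧ (hi f = lo e ∨ hi e = lo f) ∧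
    (up f ↔ up e) ∧ (down f ↔ down e)
  have huniq_of_le : ∀ e f f', P f e → P f' e → a f ≤ a f' → f = f' := by
    rintro e f f' ⟨-, hf, hee, hcf, huf, hdf⟩ ⟨-, hf', -, hcf', huf', hdf'⟩ hle
    have hff' : Alive f f' := ⟨hle, hf'.1.trans hf.2⟩
    have l1 := hlohi e
    have l2 := hlohi f
    have l3 := hlohi f'
    by_cases hu : up e
    · have h1 := hu f hf
      have h2 := hu f' hf'
      have h3 := huf'.2 hu f hff'
      have := hinj f f'
      grind
    by_cases hd : down e
    · have h1 := hd f hf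
      have h2 := hd f' hf'
      have h3 := hdf'.2 hd f hff'
      have := hinj f f'
      grind
    have hu' : ∃ g, Alive g e ∧ ¬ (hi e = lo g ∨ hi e = hi g) := by
      by_contra! h
      exact hu fun g hg => by have := h g hg; tauto
    have hd' : ∃ g, Alive g e ∧ ¬ (lo e = lo g ∨ lo e = hi g) := by
      by_contra! h
      exact hd fun g hg => by have := h g hg; tauto
    obtain ⟨g, hg, hg'⟩ := hu'
    obtain ⟨h, hh, hh'⟩ := hd'
    have l4 := hlohi g
    have l5 := hlohi h
    have he : Alive e e := ⟨le_rfl, hee⟩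
    have c1 := hclique e e g he hg
    have c2 := hclique e e h he hh
    have c3 := hclique e g h hg hh
    have c4 := hclique e f g hf hg
    have c5 := hclique e f h hf hh
    have c6 := hclique e f' g hf' hg
    have c7 := hclique e f' h hf' hh
    have c8 := hclique e f f' hf hf'
    have := hinj f f'
    clear * - l1 l2 l3 l4 l5 c1 c2 c3 c4 c5 c6 c7 c8 this hcf hcf' hg' hh'
    rcases hcf with hcf | hcf <;> rcases hcf' with hcf' | hcf' <;> grind (splits := 30)
  obtain ⟨c, hc⟩ := exists_bool_coloring_of_unique_pred P (fun f e h => h.1)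
    (fun e f f' h h' => (le_total (a f) (a f')).elim (huniq_of_le e f f' h h')
      (fun hle => (huniq_of_le e f' f h' h hle).symm))
  refine ⟨fun e => (decide (up e), decide (down e), c e), fun e f hef hne heq => ?_⟩
  obtain ⟨t, ⟨h1, h2⟩, h3, h4⟩ := hne
  simp only [Prod.mk.injEq, decide_eq_decide] at heq
  obtain ⟨hup, hdown, hcc⟩ := heq
  rcases lt_trichotomy e f with hlt | rfl | hlt
  · exact hc e f ⟨hlt, ⟨ha e f hlt, h3.trans h2⟩, h3.trans h4, Or.inl hef, hup, hdown⟩ hcc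
  · exact (hlohi e).ne' hef
  · exact hc f e ⟨hlt, ⟨ha f e hlt, h1.trans h4⟩, h1.trans h2, Or.inr hef, hup.symm, hdown.symm⟩
      hcc.symm

/-- If consecutive edges of an ordered graph receive distinct colours, mapping a vertex to the set of
colours of its edges to smaller vertices is a proper colouring. -/
theorem colorable_of_edge_coloring {V C : Type*} [LinearOrder V] [Fintype C] (G : SimpleGraph V)
    (c : G.edgeSet → C)
    (hc : ∀ e f : G.edgeSet, e.1.sup = f.1.inf → c e ≠ c f) :
    G.Colorable (2 ^ Fintype.card C) := by
  classical
  have key : ∀ x y, x < y → G.Adj x y →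
      {i | ∃ e : G.edgeSet, e.1.sup = x ∧ c e = i} ≠
        {i | ∃ e : G.edgeSet, e.1.sup = y ∧ c e = i} := by
    intro x y hxy hadj heq
    let f : G.edgeSet := ⟨s(x, y), hadj⟩
    have hf : c f ∈ {i | ∃ e : G.edgeSet, e.1.sup = y ∧ c e = i} := ⟨f, by simp [f, hxy.le], rfl⟩
    rw [← heq] at hf
    obtain ⟨e, he, hce⟩ := hf
    exact hc e f (by simp [f, he, hxy.le]) hce
  have col : G.Coloring (Set C) :=
    SimpleGraph.Coloring.mk (fun v => {i | ∃ e : G.edgeSet, e.1.sup = v ∧ c e = i}) (by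
      intro x y hadj
      rcases lt_or_gt_of_ne hadj.ne with h | h
      · exact key x y h hadj
      · exact (key y x h hadj.symm).symm)
  simpa using col.colorable

/-- If the line graph of a finite graph is a union of `k` interval graphs, the graph itself has
chromatic number at most `2 ^ 8 ^ k`. -/
theorem colorable_of_lineGraph_interval_cover {V : Type*} [Finite V] (G : SimpleGraph V) {k : ℕ}
    (I : Fin k → SimpleGraph G.edgeSet) (hI : ∀ i, IsIntervalGraph (I i))
    (hsup : (⨆ i, I i) = G.lineGraph) : G.Colorable (2 ^ 8 ^ k) := by
  classical
  let _ : LinearOrder V := LinearOrder.lift' (Finite.equivFin V) (Finite.equivFin V).injective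
  have hmk : ∀ e : Sym2 V, e = s(e.inf, e.sup) := fun e => by
    induction e with
    | _ x y => rcases le_total x y with h | h <;> simp [h, Sym2.eq_swap]
  have hlt : ∀ e : G.edgeSet, e.1.inf < e.1.sup := fun e => by
    obtain ⟨e, he⟩ := e
    rw [hmk e, SimpleGraph.mem_edgeSet] at he
    exact lt_of_le_of_ne (Sym2.inf_le_sup e) he.ne
  have hcol : ∀ i, ∃ c : G.edgeSet → Bool × Bool × Bool, ∀ e f, e.1.sup = f.1.inf →
      (I i).Adj e f → c e ≠ c f := by
    intro i
    obtain ⟨a, b, -, hadj⟩ := hI i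
    obtain ⟨c, hc⟩ := exists_coloring_of_intervals (fun e : G.edgeSet => e.1.inf)
      (fun e => e.1.sup) hlt
      (fun e f h h' => Subtype.ext (by rw [hmk e.1, hmk f.1, h, h'])) a b (by
        intro e f t h1 h2 h3 h4
        by_cases hef : e = f
        · exact Or.inl (by rw [hef])
        have h : G.lineGraph.Adj e f := by
          rw [← hsup, SimpleGraph.iSup_adj]
          exact ⟨i, (hadj e f).2 ⟨hef, t, ⟨h1, h2⟩, h3, h4⟩⟩
        rw [SimpleGraph.lineGraph_adj_iff_exists] at h
        obtain ⟨-, v, hve, hvf⟩ := h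
        rw [hmk e.1, Sym2.mem_iff] at hve
        rw [hmk f.1, Sym2.mem_iff] at hvf
        grind)
    exact ⟨c, fun e f h hef => hc e f h ((hadj e f).1 hef).2⟩
  choose c hc using hcol
  have := colorable_of_edge_coloring G (fun e i => c i e) (by
    intro e f hef heq
    have h : G.lineGraph.Adj e f := by
      rw [SimpleGraph.lineGraph_adj_iff_exists]
      refine ⟨?_, e.1.sup, ?_, ?_⟩
      · rintro rfl
        exact (hlt e).ne' hef
      · exact (congrArg (e.1.sup ∈ ·) (hmk e.1)).mpr (Sym2.mem_mk_right _ _)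
      · exact hef ▸ (congrArg (f.1.inf ∈ ·) (hmk f.1)).mpr (Sym2.mem_mk_left _ _)
    rw [← hsup, SimpleGraph.iSup_adj] at h
    obtain ⟨i, hi⟩ := h
    exact hc i e f hef hi (congrFun heq i))
  simpa using this

/-- The graph joining distinct elements with the same value under a map to a finite type is an
interval graph. -/
theorem isIntervalGraph_of_fibers {E W : Type*} [Finite W] (H : SimpleGraph E) (φ : E → W)
    (h : ∀ e f, H.Adj e f ↔ e ≠ f ∧ φ e = φ f) : IsIntervalGraph H := by
  let p : E → ℝ := fun e => (Finite.equivFin W (φ e) : ℕ)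
  refine ⟨p, p, fun _ => le_rfl, fun e f => ?_⟩
  rw [h, Set.Icc_self, Set.Icc_self, Set.singleton_inter_nonempty, Set.mem_singleton_iff]
  simp [p, Fin.val_inj]

/-- The line graph of a finite `n`-colourable graph is a union of `n` interval graphs. -/
theorem exists_lineGraph_interval_cover_of_colorable {V : Type*} [Finite V] (G : SimpleGraph V)
    {n : ℕ} (hG : G.Colorable n) :
    ∃ I : Fin n → SimpleGraph G.edgeSet,
      (∀ i, IsIntervalGraph (I i)) ∧ (⨆ i, I i) = G.lineGraph := by
  classical
  obtain ⟨col⟩ := hG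
  let φ : Fin n → G.edgeSet → V ⊕ G.edgeSet := fun i e =>
    if h : ∃ v ∈ e.1, col v = i then Sum.inl h.choose else Sum.inr e
  have hφ : ∀ (e : G.edgeSet) v, v ∈ e.1 → φ (col v) e = Sum.inl v := by
    intro e v hv
    have h : ∃ w ∈ e.1, col w = col v := ⟨v, hv, rfl⟩
    have hw := h.choose_spec
    simp only [φ, dif_pos h, Sum.inl.injEq]
    by_contra hne
    have he := (Sym2.mem_and_mem_iff hne).1 ⟨hw.1, hv⟩
    have hadj : G.Adj h.choose v := by
      rw [← SimpleGraph.mem_edgeSet, ← he]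
      exact e.2
    exact col.valid hadj hw.2
  have hmem : ∀ i (e : G.edgeSet) v, φ i e = Sum.inl v → v ∈ e.1 := by
    intro i e v h
    by_cases hex : ∃ v ∈ e.1, col v = i
    · simp only [φ, dif_pos hex, Sum.inl.injEq] at h
      exact h ▸ hex.choose_spec.1
    · simp [φ, dif_neg hex] at h
  have hinr : ∀ i (e f : G.edgeSet), φ i e = Sum.inr f → e = f := by
    intro i e f h
    by_cases hex : ∃ v ∈ e.1, col v = i
    · simp [φ, dif_pos hex] at h
    · simpa [φ, dif_neg hex] using h
  let I : Fin n → SimpleGraph G.edgeSet := fun i =>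
    { Adj := fun e f => e ≠ f ∧ φ i e = φ i f
      symm := ⟨fun _ _ h => ⟨h.1.symm, h.2.symm⟩⟩
      loopless := ⟨fun _ h => h.1 rfl⟩ }
  refine ⟨I, fun i => isIntervalGraph_of_fibers (I i) (φ i) fun _ _ => Iff.rfl, ?_⟩
  ext e f
  rw [SimpleGraph.iSup_adj, SimpleGraph.lineGraph_adj_iff_exists]
  constructor
  · rintro ⟨i, hne, h⟩
    refine ⟨hne, ?_⟩
    cases hf : φ i f with
    | inl v => exact ⟨v, hmem i e v (h.trans hf), hmem i f v hf⟩
    | inr g => exact absurd ((hinr i e g (h.trans hf)).trans (hinr i f g hf).symm) hne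
  · rintro ⟨hne, v, hve, hvf⟩
    exact ⟨col v, hne, (hφ e v hve).trans (hφ f v hvf).symm⟩

theorem stmt_12 {ι : Type*} (V : ι → Type*) [∀ i, Fintype (V i)]
    (G : ∀ i, SimpleGraph (V i)) :
    (∃ B : ℕ, ∀ i, trackNumber (G i).lineGraph ≤ B) ↔
    (∃ B : ℕ, ∀ i, (G i).chromaticNumber ≤ B) := by
  constructor
  · rintro ⟨B, hB⟩
    refine ⟨2 ^ 8 ^ B, fun i => ?_⟩
    rw [SimpleGraph.chromaticNumber_le_iff_colorable]
    obtain ⟨I, hI, hsup⟩ := Nat.sInf_mem (s := {k | ∃ f : Fin k → SimpleGraph (G i).edgeSet,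
      (∀ j, IsIntervalGraph (f j)) ∧ (⨆ j, f j) = (G i).lineGraph})
      ⟨_, exists_lineGraph_interval_cover_of_colorable (G i) (G i).colorable_of_fintype⟩
    exact (colorable_of_lineGraph_interval_cover (G i) I hI hsup).mono
      (Nat.pow_le_pow_right two_pos (Nat.pow_le_pow_right (by norm_num) (hB i)))
  · rintro ⟨B, hB⟩
    refine ⟨B, fun i => Nat.sInf_le ?_⟩
    exact exists_lineGraph_interval_cover_of_colorable (G i)
      (SimpleGraph.chromaticNumber_le_iff_colorable.1 (hB i))
end

section
/- The track number of chordal graphs is unbounded: for every integer k ≥ 1 there exists a chordal graph G with τ(G) > k. -/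
open SimpleGraph

/-- A graph whose vertex set splits into a clique and an independent set is chordal. -/
lemma isChordal_of_split {V : Type*} {G : SimpleGraph V} (A : Set V)
    (hA : ∀ u ∈ A, ∀ v ∈ A, u ≠ v → G.Adj u v) (hB : ∀ u ∉ A, ∀ v ∉ A, ¬ G.Adj u v) :
    IsChordal G := by
  intro n hn
  obtain ⟨m, rfl⟩ : ∃ m, n = m + 4 := ⟨n - 4, by omega⟩
  refine ⟨fun φ => ?_⟩
  have hone : ∀ i : Fin (m + 4), G.Adj (φ i) (φ (i + 1)) := fun i =>
    φ.map_adj_iff.2 (cycleGraph_adj.2 (Or.inr (by abel)))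
  have htwo : ∀ i : Fin (m + 4), ¬ G.Adj (φ i) (φ (i + 1 + 1)) := by
    intro i h
    rcases cycleGraph_adj.1 (φ.map_adj_iff.1 h) with h | h
    · have h3 : (1 + 1 + 1 : Fin (m + 4)) = 0 := by
        calc (1 + 1 + 1 : Fin (m + 4)) = (i - (i + 1 + 1)) + 1 + 1 := by rw [h]
          _ = 0 := by abel
      have := congrArg Fin.val h3
      simp [Fin.val_add] at this
      rw [Nat.mod_eq_of_lt (by omega)] at this
      omega
    · have h2 : (1 : Fin (m + 4)) = 0 := by
        calc (1 : Fin (m + 4)) = (i + 1 + 1 - i) - 1 := by abel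
          _ = 0 := by rw [h]; abel
      simp at h2
  have hne : ∀ i : Fin (m + 4), φ i ≠ φ (i + 1 + 1) := by
    intro i h
    have h2 : (1 + 1 : Fin (m + 4)) = 0 := by
      calc (1 + 1 : Fin (m + 4)) = (i + 1 + 1) - i := by abel
        _ = 0 := by rw [← φ.injective h]; abel
    have := congrArg Fin.val h2
    simp [Fin.val_add] at this
    rw [Nat.mod_eq_of_lt (by omega)] at this
    omega
  have key : ∀ i : Fin (m + 4), φ i ∉ A := by
    intro i hi
    have h2 : φ (i + 1 + 1) ∉ A := fun h => htwo i (hA _ hi _ h (hne i))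
    have h1 : φ (i + 1) ∈ A := by
      by_contra h
      exact hB _ h _ h2 (hone (i + 1))
    have h3 : φ (i + 1 + 1 + 1) ∈ A := by
      by_contra h
      exact hB _ h2 _ h (hone (i + 1 + 1))
    exact htwo _ (hA _ h1 _ h3 (hne _))
  exact hB _ (key 0) _ (key (0 + 1)) (hone 0)

lemma isIntervalGraph_of_points {V : Type*} {G : SimpleGraph V} (c : V → ℝ)
    (h : ∀ u v, G.Adj u v ↔ u ≠ v ∧ c u = c v) : IsIntervalGraph G := by
  refine ⟨c, c, fun _ => le_rfl, fun u v => ?_⟩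
  rw [h]
  simp [eq_comm]

lemma IsIntervalGraph.comap {V W : Type*} {G : SimpleGraph V} (h : IsIntervalGraph G)
    (e : W ↪ V) : IsIntervalGraph (G.comap e) := by
  obtain ⟨a, b, hab, hadj⟩ := h
  refine ⟨a ∘ e, b ∘ e, fun v => hab _, fun u v => ?_⟩
  simp [hadj, e.injective.ne_iff]

lemma isIntervalGraph_inf_edge {n : ℕ} (G : SimpleGraph (Fin n)) (u v : Fin n) :
    IsIntervalGraph (G ⊓ edge u v) := by
  classical
  by_cases huv : G.Adj u v
  · refine isIntervalGraph_of_points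
      (fun w => if w = u ∨ w = v then -1 else ((w : ℕ) : ℝ)) fun x y => ?_
    have hx : ∀ z : Fin n, ((z : ℕ) : ℝ) ≠ -1 := fun z => by
      have : (0 : ℝ) ≤ ((z : ℕ) : ℝ) := Nat.cast_nonneg _
      linarith
    have hvu := huv.symm
    have hinj : ((x : ℕ) : ℝ) = ((y : ℕ) : ℝ) ↔ x = y := by
      rw [Nat.cast_inj, Fin.ext_iff]
    have := hx x
    have := hx y
    simp only [inf_adj, edge_adj]
    split_ifs <;> grind
  · refine isIntervalGraph_of_points (fun w => ((w : ℕ) : ℝ)) fun x y => ?_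
    have hvu : ¬ G.Adj v u := fun h => huv h.symm
    have hinj : ((x : ℕ) : ℝ) = ((y : ℕ) : ℝ) ↔ x = y := by
      rw [Nat.cast_inj, Fin.ext_iff]
    simp only [inf_adj, edge_adj, hinj]
    grind

/-- Every finite graph is a finite union of interval graphs. -/
lemma exists_interval_cover {n : ℕ} (G : SimpleGraph (Fin n)) :
    ∃ (k : ℕ) (f : Fin k → SimpleGraph (Fin n)),
      (∀ i, IsIntervalGraph (f i)) ∧ (⨆ i, f i) = G := by
  let e := Fintype.equivFin (Fin n × Fin n)
  refine ⟨_, fun i => G ⊓ edge (e.symm i).1 (e.symm i).2,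
    fun i => isIntervalGraph_inf_edge _ _ _, ?_⟩
  ext x y
  simp only [iSup_adj, inf_adj, edge_adj]
  constructor
  · rintro ⟨i, h, -⟩
    exact h
  · intro h
    exact ⟨e (x, y), h, by simp [h.ne]⟩

/-- The split graph with clique `Fin (k + 1) × (ι → Bool)` and independent set
`ι → Fin (k + 1) → Bool`, where a word is adjacent to each of its `k + 1` projections. -/
def projectionSplitGraph (k : ℕ) (ι : Type*) :
    SimpleGraph ((Fin (k + 1) × (ι → Bool)) ⊕ (ι → Fin (k + 1) → Bool)) where
  Adj
    | .inl s, .inl t => s ≠ t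
    | .inl s, .inr x => s.2 = fun j => x j s.1
    | .inr x, .inl s => s.2 = fun j => x j s.1
    | .inr _, .inr _ => False
  symm := ⟨by rintro (s | x) (t | y) h <;> first | exact h | exact h.symm⟩
  loopless := ⟨by rintro (s | x) h <;> first | exact h | exact h rfl⟩

lemma isChordal_projectionSplitGraph (k : ℕ) (ι : Type*) :
    IsChordal (projectionSplitGraph k ι) := by
  refine isChordal_of_split (Set.range Sum.inl) ?_ ?_
  · rintro _ ⟨s, rfl⟩ _ ⟨t, rfl⟩ h
    exact fun hst => h (congrArg _ hst)
  · rintro (s | x) hs (t | y) ht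
    · exact absurd ⟨s, rfl⟩ hs
    · exact absurd ⟨s, rfl⟩ hs
    · exact absurd ⟨t, rfl⟩ ht
    · exact id

/-- The subdivision of a four-cycle, with arbitrary edges allowed among the four original
vertices `P b` and `Q b`, is not induced in an interval graph. -/
lemma IsIntervalGraph.false_of_subdivided_square {V : Type*} {H : SimpleGraph V}
    (hH : IsIntervalGraph H) (v : Bool → Bool → V) (P Q : Bool → V)
    (hinj : ∀ b c b' c', v b c = v b' c' → b = b' ∧ c = c')
    (hv : ∀ b c b' c', ¬ H.Adj (v b c) (v b' c'))
    (hPv : ∀ a b c, P a ≠ v b c) (hQv : ∀ a b c, Q a ≠ v b c)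
    (hP : ∀ a b c, H.Adj (P a) (v b c) ↔ a = b)
    (hQ : ∀ a b c, H.Adj (Q a) (v b c) ↔ a = c) : False := by
  obtain ⟨l, r, hlr, hadj⟩ := hH
  have hmeet : ∀ u w, (Set.Icc (l u) (r u) ∩ Set.Icc (l w) (r w)).Nonempty ↔
      l u ≤ r w ∧ l w ≤ r u := by
    intro u w
    have := hlr u
    have := hlr w
    rw [Set.Icc_inter_Icc, Set.nonempty_Icc]
    simp only [sup_le_iff, le_inf_iff]
    tauto
  simp only [hmeet] at hadj
  have between : ∀ p e f g, H.Adj p e → H.Adj p g → ¬ H.Adj p f → p ≠ f →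
      r e < l f → r f < l g → False := by
    intro p e f g he hg hf hne h1 h2
    have h3 := ((hadj p e).1 he).2
    have h4 := ((hadj p g).1 hg).2
    have := hlr f
    exact hf ((hadj p f).2 ⟨hne, by linarith, by linarith⟩)
  have disj : ∀ b c b' c', (b ≠ b' ∨ c ≠ c') →
      r (v b c) < l (v b' c') ∨ r (v b' c') < l (v b c) := by
    intro b c b' c' h
    by_contra! hcon
    refine hv b c b' c' ((hadj _ _).2 ⟨fun he => ?_, hcon.2, hcon.1⟩)
    have := hinj _ _ _ _ he
    tauto
  have bP : ∀ b c c' d, ¬ (r (v b c) < l (v (!b) d) ∧ r (v (!b) d) < l (v b c')) := by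
    rintro b c c' d ⟨h1, h2⟩
    exact between (P b) _ _ _ ((hP _ _ _).2 rfl) ((hP _ _ _).2 rfl)
      (by rw [hP]; simp) (hPv _ _ _) h1 h2
  have bQ : ∀ c b b' d, ¬ (r (v b c) < l (v d (!c)) ∧ r (v d (!c)) < l (v b' c)) := by
    rintro c b b' d ⟨h1, h2⟩
    exact between (Q c) _ _ _ ((hQ _ _ _).2 rfl) ((hQ _ _ _).2 rfl)
      (by rw [hQ]; simp) (hQv _ _ _) h1 h2
  have d1 := disj false false false true (by simp)
  have d2 := disj false false true false (by simp)
  have d3 := disj false false true true (by simp)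
  have d4 := disj false true true false (by simp)
  have d5 := disj false true true true (by simp)
  have d6 := disj true false true true (by simp)
  simp only [Bool.forall_bool, Bool.not_true, Bool.not_false] at bP bQ
  grind

/-- For a suitable finite `ι`, given by the Hales-Jewett theorem, the graph
`projectionSplitGraph k ι` is not a union of at most `k` interval graphs. -/
lemma exists_projectionSplitGraph_not_cover (k : ℕ) :
    ∃ (ι : Type) (_ : Fintype ι), ∀ j ≤ k, ∀ f : Fin j → SimpleGraph _,
      (∀ i, IsIntervalGraph (f i)) → (⨆ i, f i) ≠ projectionSplitGraph k ι := by
  classical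
  obtain ⟨ι, hι, hmono⟩ := Combinatorics.Line.exists_mono_in_high_dimension
    (Fin (k + 1) → Bool) (Fin k × Fin (k + 1) × Fin (k + 1))
  refine ⟨ι, hι, fun j hj f hf hsup => ?_⟩
  have hle : ∀ i u w, (f i).Adj u w → (projectionSplitGraph k ι).Adj u w := fun i u w h => by
    rw [← hsup]
    exact iSup_adj.2 ⟨i, h⟩
  have hcol : ∀ (x : ι → Fin (k + 1) → Bool) (p : Fin (k + 1)),
      ∃ i, (f i).Adj (.inl (p, fun t => x t p)) (.inr x) := by
    intro x p
    rw [← iSup_adj, hsup]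
    exact rfl
  choose c hc using hcol
  have hpair : ∀ x, ∃ p q, p ≠ q ∧ c x p = c x q := fun x =>
    Fintype.exists_ne_map_eq_of_card_lt (c x) (by simp; omega)
  choose p q hpq hcpq using hpair
  obtain ⟨L, ⟨⟨i₀, p₀, q₀⟩, hL⟩⟩ := hmono fun x => (Fin.castLE hj (c x (p x)), p x, q x)
  simp only [Prod.mk.injEq] at hL
  obtain ⟨t₀, ht₀⟩ := L.proper
  let A : Bool → Bool → Fin (k + 1) → Bool := fun b d s => if s = p₀ then b else d
  have hne : p₀ ≠ q₀ := by
    have h := hL (A false false)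
    have := hpq (L (A false false))
    rwa [h.2.1, h.2.2] at this
  have hLt : ∀ a, L a t₀ = a := fun a => by simp [ht₀]
  have hproj : ∀ (a a' : Fin (k + 1) → Bool) s, a s = a' s →
      (fun t => L a t s) = fun t => L a' t s := by
    intro a a' s h
    funext t
    simp only [Combinatorics.Line.apply_def]
    cases L.idxFun t <;> simp [h]
  have hAp : ∀ b d, A b d p₀ = b := fun b d => by simp [A]
  have hAq : ∀ b d, A b d q₀ = d := fun b d => by simp [A, hne.symm]
  set i := c (L (A false false)) (p (L (A false false))) with hi
  have hci : ∀ a, c (L a) p₀ = i ∧ c (L a) q₀ = i := by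
    intro a
    have h1 := hL a
    have h2 := hL (A false false)
    have h3 : c (L a) (p (L a)) = i :=
      Fin.castLE_injective hj (h1.1.trans h2.1.symm)
    have h4 := hcpq (L a)
    rw [h1.2.1] at h3
    rw [h1.2.1, h1.2.2] at h4
    exact ⟨h3, h4 ▸ h3⟩
  have hinc : ∀ (s : Fin (k + 1)) (a a' : Fin (k + 1) → Bool), c (L a') s = i →
      ((f i).Adj (.inl (s, fun t => L a t s)) (.inr (L a')) ↔ a s = a' s) := by
    intro s a a' hs
    constructor
    · intro h
      have h' : (fun t => L a t s) = fun t => L a' t s := hle _ _ _ h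
      have h0 := congrFun h' t₀
      rwa [hLt, hLt] at h0
    · intro h
      rw [hproj a a' s h]
      have := hc (L a') s
      rwa [hs] at this
  refine (hf i).false_of_subdivided_square (fun b d => .inr (L (A b d)))
    (fun b => .inl (p₀, fun t => L (A b false) t p₀))
    (fun d => .inl (q₀, fun t => L (A false d) t q₀)) ?_ ?_ ?_ ?_ ?_ ?_
  · intro b d b' d' h
    have h' : A b d = A b' d' := by
      rw [← hLt (A b d), ← hLt (A b' d'), Sum.inr.inj h]
    exact ⟨by rw [← hAp b d, h', hAp], by rw [← hAq b d, h', hAq]⟩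
  · intro b d b' d' h
    exact hle _ _ _ h
  · simp
  · simp
  · intro a b d
    rw [hinc p₀ _ _ (hci _).1, hAp, hAp]
  · intro a b d
    rw [hinc q₀ _ _ (hci _).2, hAq, hAq]

theorem stmt_16 (k : ℕ) (hk : 1 ≤ k) :
    ∃ (n : ℕ) (G : SimpleGraph (Fin n)), IsChordal G ∧ k < trackNumber G := by
  classical
  obtain ⟨ι, hι, hcover⟩ := exists_projectionSplitGraph_not_cover k
  let e := Fintype.equivFin ((Fin (k + 1) × (ι → Bool)) ⊕ (ι → Fin (k + 1) → Bool))
  refine ⟨_, (projectionSplitGraph k ι).comap e.symm, fun n hn => ⟨fun φ => ?_⟩, ?_⟩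
  · exact (isChordal_projectionSplitGraph k ι n hn).false
      ((Embedding.comap e.symm.toEmbedding _).comp φ)
  · by_contra! hle
    obtain ⟨f, hf, hsup⟩ := Nat.sInf_mem
      (s := {j | ∃ f : Fin j → SimpleGraph _, (∀ i, IsIntervalGraph (f i)) ∧
        (⨆ i, f i) = (projectionSplitGraph k ι).comap e.symm}) (exists_interval_cover _)
    refine hcover _ hle (fun i => (f i).comap e) (fun i => (hf i).comap e.toEmbedding) ?_
    ext u w
    have h : (⨆ i, f i).Adj (e u) (e w) ↔ (projectionSplitGraph k ι).Adj u w := by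
      rw [hsup]
      simp
    rw [← h]
    simp only [iSup_adj, comap_adj]
    rfl
end
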